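/- arXiv:2403.19701 — 10 statements merged into one kernel-verified Lean document; each statement's English description precedes it below -/
import Mathlib

section
/- Let m ≥ 1 be an integer. For all integers n ≥ m, ∑_{j=0}^{n-m} F^{(m)}(j) · F^{(m+1)}(n-m-j) = F^{(m+1)}(n) − F^{(m)}(n). -/
/-- Fibonacci `m`-step numbers: `fibm m 0 = 0`, `fibm m 1 = 1`, and for `n ≥ 2`,
`fibm m n = ∑_{j=1}^{m} fibm m (n - j)`, negative indices counting as `0`
(equivalently via truncated subtraction, since `fibm m 0 = 0`). -/
def fibm (m : ℕ) : ℕ → ℤ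
  | 0 => 0
  | 1 => 1
  | n + 2 => ∑ j ∈ Finset.range m, fibm m (n + 1 - j)
decreasing_by exact Nat.lt_succ_of_le (Nat.sub_le _ _)

open PowerSeries in
/-- The generating function `F` of the Fibonacci `m`-step numbers satisfies
`F * (1 - X - ⋯ - X ^ m) = X`. -/
theorem mk_fibm_mul (m : ℕ) :
    mk (fibm m) * (1 - ∑ i ∈ Finset.range m, (X : ℤ⟦X⟧) ^ (i + 1)) = X := by
  suffices h : mk (fibm m) =
      X + ∑ i ∈ Finset.range m, (X : ℤ⟦X⟧) ^ (i + 1) * mk (fibm m) by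
    rw [← Finset.sum_mul] at h
    linear_combination h
  ext n
  simp only [map_add, map_sum, coeff_X_pow_mul', coeff_mk, coeff_X]
  match n with
  | 0 => simp [fibm]
  | 1 => simp [fibm]
  | n + 2 =>
    rw [fibm, if_neg (by omega), zero_add]
    refine Finset.sum_congr rfl fun j _ => ?_
    split_ifs with h
    · congr 1
      omega
    · rw [show n + 1 - j = 0 by omega, fibm]

open PowerSeries in
/-- The convolution of consecutive Fibonacci multi-step sequences, as an identity of
generating functions. -/
theorem X_pow_mul_mk_fibm_mul_mk_fibm (m : ℕ) :
    (X : ℤ⟦X⟧) ^ m * (mk (fibm m) * mk (fibm (m + 1))) =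
      mk (fibm (m + 1)) - mk (fibm m) := by
  have h₁ := mk_fibm_mul m
  have h₂ := mk_fibm_mul (m + 1)
  rw [Finset.sum_range_succ] at h₂
  refine mul_left_cancel₀ (X_ne_zero (R := ℤ)) ?_
  linear_combination mk (fibm (m + 1)) * h₁ - mk (fibm m) * h₂

theorem stmt_0 (m : ℕ) (hm : 1 ≤ m) (n : ℕ) (hn : m ≤ n) :
    ∑ j ∈ Finset.range (n - m + 1), fibm m j * fibm (m + 1) (n - m - j) =
      fibm (m + 1) n - fibm m n := by
  have h := congrArg (PowerSeries.coeff n) (X_pow_mul_mk_fibm_mul_mk_fibm m)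
  rw [PowerSeries.coeff_X_pow_mul', if_pos hn, PowerSeries.coeff_mul,
    Finset.Nat.sum_antidiagonal_eq_sum_range_succ_mk] at h
  simpa using h
end

section
/- Let m ≥ 1 and p ≥ 1 be integers. For all integers n ≥ m, ∑_{k=0}^{p-1} ∑_{j=0}^{n-m-k} F^{(m)}(j) · F^{(m+p)}(n-m-k-j) = F^{(m+p)}(n) − F^{(m)}(n). -/
open PowerSeries in
/-- The generating function of the Fibonacci `m`-step numbers satisfies
`G = X + (X + X ^ 2 + ⋯ + X ^ m) * G`. -/
theorem mk_fibm_eq (m : ℕ) :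
    mk (fibm m) = X + ∑ j ∈ Finset.range m, X ^ (j + 1) * mk (fibm m) := by
  ext n
  simp only [map_add, map_sum, coeff_X_pow_mul', coeff_mk, coeff_X]
  match n with
  | 0 => simp [fibm]
  | 1 =>
    rw [Finset.sum_eq_zero]
    · simp [fibm]
    · intro j _
      have h : 1 - (j + 1) = 0 := by omega
      simp [h, fibm]
  | n + 2 =>
    rw [fibm, if_neg (by omega), zero_add]
    refine Finset.sum_congr rfl fun j _ => ?_
    split_ifs with h
    · congr 1
      omega
    · rw [show n + 1 - j = 0 by omega, fibm]

open PowerSeries in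
/-- The difference of the generating functions of the `(m + p)`-step and `m`-step Fibonacci
numbers is `X ^ m + ⋯ + X ^ (m + p - 1)` times their product. -/
theorem mk_fibm_add_sub (m p : ℕ) :
    mk (fibm (m + p)) - mk (fibm m) =
      ∑ k ∈ Finset.range p, X ^ (m + k) * (mk (fibm m) * mk (fibm (m + p))) := by
  have h₁ := mk_fibm_eq m
  have h₂ := mk_fibm_eq (m + p)
  rw [Finset.sum_range_add] at h₂
  simp only [pow_succ', mul_assoc, ← Finset.mul_sum, ← Finset.sum_mul] at h₁ h₂ ⊢
  apply mul_left_cancel₀ (X_ne_zero (R := ℤ))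
  linear_combination mk (fibm m) * h₂ - mk (fibm (m + p)) * h₁

theorem stmt_1 (m p : ℕ) (hm : 1 ≤ m) (hp : 1 ≤ p) (n : ℕ) (hn : m ≤ n) :
    ∑ k ∈ Finset.range p, ∑ j ∈ Finset.range (n - m - k + 1),
        fibm m j * fibm (m + p) (n - m - k - j) =
      fibm (m + p) n - fibm m n := by
  have h := congrArg (PowerSeries.coeff n) (mk_fibm_add_sub m p)
  simp only [map_sub, map_sum, PowerSeries.coeff_X_pow_mul', PowerSeries.coeff_mk] at h
  rw [h]
  refine Finset.sum_congr rfl fun k _ => ?_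
  split_ifs with hk
  · rw [PowerSeries.coeff_mul, Finset.Nat.sum_antidiagonal_eq_sum_range_succ_mk, Nat.sub_sub]
    simp only [PowerSeries.coeff_mk]
  · rw [show n - m - k = 0 by omega]
    simp [fibm]
end

section
/- For every integer n ≥ 0, ∑_{j=0}^{n} F(j) · T(n-j) = T(n+2) − F(n+2). -/
theorem fibm_two_add_two (n : ℕ) : fibm 2 (n + 2) = fibm 2 (n + 1) + fibm 2 n := by
  rw [fibm]
  simp [Finset.sum_range_succ]

theorem fibm_three_add_three (n : ℕ) :
    fibm 3 (n + 3) = fibm 3 (n + 2) + fibm 3 (n + 1) + fibm 3 n := by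
  rw [fibm]
  simp [Finset.sum_range_succ]

/-- The convolution of the Fibonacci numbers with any sequence `g` satisfies the Fibonacci
recurrence with forcing term `g`. -/
theorem sum_fibm_two_mul_add_two (g : ℕ → ℤ) (n : ℕ) :
    ∑ j ∈ Finset.range (n + 3), fibm 2 j * g (n + 2 - j) =
      g (n + 1) + ∑ j ∈ Finset.range (n + 2), fibm 2 j * g (n + 1 - j) +
        ∑ j ∈ Finset.range (n + 1), fibm 2 j * g (n - j) := by
  have h0 : fibm 2 0 = 0 := by rw [fibm]
  have h1 : fibm 2 1 = 1 := by rw [fibm]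
  rw [Finset.sum_range_succ', Finset.sum_range_succ', Finset.sum_range_succ' _ (n + 1)]
  simp only [Nat.add_sub_add_right, add_assoc, Nat.reduceAdd, fibm_two_add_two, add_mul,
    Finset.sum_add_distrib, h0, h1]
  norm_num
  ring

theorem stmt_2 (n : ℕ) :
    ∑ j ∈ Finset.range (n + 1), fibm 2 j * fibm 3 (n - j) =
      fibm 3 (n + 2) - fibm 2 (n + 2) := by
  induction n using Nat.twoStepInduction with
  | zero => simp [fibm, Finset.sum_range_succ]
  | one => simp [fibm, Finset.sum_range_succ]
  | more n ih₀ ih₁ =>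
    rw [sum_fibm_two_mul_add_two, ih₀, ih₁, fibm_three_add_three (n + 1),
      fibm_two_add_two (n + 2)]
    ring
end

section
/- For every integer n ≥ 0, ∑_{j=0}^{n} F(j+2) · Q(n-j) = Q(n+3) − F(n+3). -/
theorem fibm_add_two (m n : ℕ) :
    fibm m (n + 2) = ∑ j ∈ Finset.range m, fibm m (n + 1 - j) := by
  rw [fibm]

theorem fibm_four_add_four (n : ℕ) :
    fibm 4 (n + 4) = fibm 4 (n + 3) + fibm 4 (n + 2) + fibm 4 (n + 1) + fibm 4 n := by
  rw [fibm_add_two 4 (n + 2)]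
  simp [Finset.sum_range_succ]

theorem stmt_4 (n : ℕ) :
    ∑ j ∈ Finset.range (n + 1), fibm 2 (j + 2) * fibm 4 (n - j) =
      fibm 4 (n + 3) - fibm 2 (n + 3) := by
  have hF0 : fibm 2 0 = 0 := by rw [fibm]
  have hF1 : fibm 2 1 = 1 := by rw [fibm]
  have hF2 : fibm 2 2 = 1 := by rw [fibm_two_add_two 0, hF0, hF1]; rfl
  have hF3 : fibm 2 3 = 2 := by rw [fibm_two_add_two 1, hF1, hF2]; rfl
  have hF4 : fibm 2 4 = 3 := by rw [fibm_two_add_two 2, hF2, hF3]; rfl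
  have hQ0 : fibm 4 0 = 0 := by rw [fibm]
  have hQ1 : fibm 4 1 = 1 := by rw [fibm]
  have hQ2 : fibm 4 2 = 1 := by
    simp [fibm_add_two 4 0, Finset.sum_range_succ, hQ0, hQ1]
  have hQ3 : fibm 4 3 = 2 := by
    simp [fibm_add_two 4 1, Finset.sum_range_succ, hQ0, hQ1, hQ2]
  have hQ4 : fibm 4 4 = 4 := by
    rw [fibm_four_add_four 0]; simp [hQ0, hQ1, hQ2, hQ3]
  induction n using Nat.twoStepInduction with
  | zero => simp [hQ0, hQ3, hF3]
  | one => simp [Finset.sum_range_succ, hQ0, hQ1, hQ4, hF2, hF4]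
  | more n ih₀ ih₁ =>
    rw [Finset.sum_range_succ'] at ih₁ ⊢
    rw [Finset.sum_range_succ']
    have hsum : ∑ j ∈ Finset.range (n + 1), fibm 2 (j + 1 + 1 + 2) * fibm 4 (n + 2 - (j + 1 + 1)) =
        ∑ j ∈ Finset.range (n + 1), fibm 2 (j + 1 + 2) * fibm 4 (n + 1 - (j + 1)) +
          ∑ j ∈ Finset.range (n + 1), fibm 2 (j + 2) * fibm 4 (n - j) := by
      rw [← Finset.sum_add_distrib]
      refine Finset.sum_congr rfl fun j _ => ?_
      rw [fibm_two_add_two (j + 1 + 1), Nat.add_sub_add_right, Nat.add_sub_add_right,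
        add_mul]
    have hF := fibm_two_add_two (n + 3)
    have hQ := fibm_four_add_four (n + 1)
    simp only [Nat.zero_add, Nat.sub_zero, Nat.reduceAdd, Nat.add_assoc, hF2, hF3,
      Nat.reduceSubDiff] at *
    linarith
end

section
/- For every integer n ≥ 1, 2 · ∑_{j=0}^{n} P(j) · T(n-j) = P(n+3) + P(n+1) + P(n-1) − T(n+3) − T(n+1). -/
theorem fibm_zero (m : ℕ) : fibm m 0 = 0 := by
  rw [fibm]

theorem fibm_one (m : ℕ) : fibm m 1 = 1 := by
  rw [fibm]

theorem fibm_three_two : fibm 3 2 = 1 := by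
  simp [fibm_add_two 3 0, Finset.sum_range_succ, fibm_zero, fibm_one]

theorem fibm_five_two : fibm 5 2 = 1 := by
  simp [fibm_add_two 5 0, Finset.sum_range_succ, fibm_zero, fibm_one]

theorem fibm_five_three : fibm 5 3 = 2 := by
  simp [fibm_add_two 5 1, Finset.sum_range_succ, fibm_zero, fibm_one, fibm_five_two]

theorem fibm_five_four : fibm 5 4 = 4 := by
  simp [fibm_add_two 5 2, Finset.sum_range_succ, fibm_zero, fibm_one, fibm_five_two,
    fibm_five_three]

theorem fibm_five_add_five (n : ℕ) :
    fibm 5 (n + 5) =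
      fibm 5 (n + 4) + fibm 5 (n + 3) + fibm 5 (n + 2) + fibm 5 (n + 1) + fibm 5 n := by
  simp [fibm_add_two 5 (n + 3), Finset.sum_range_succ]

/-- Convolving any sequence with the Tribonacci numbers gives a sequence satisfying the Tribonacci
recurrence with the original sequence as forcing term. -/
theorem sum_mul_fibm_three_add_three (f : ℕ → ℤ) (n : ℕ) :
    ∑ j ∈ Finset.range (n + 4), f j * fibm 3 (n + 3 - j) =
      ∑ j ∈ Finset.range (n + 3), f j * fibm 3 (n + 2 - j) +
      ∑ j ∈ Finset.range (n + 2), f j * fibm 3 (n + 1 - j) +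
      ∑ j ∈ Finset.range (n + 1), f j * fibm 3 (n - j) + f (n + 2) := by
  have h : ∑ j ∈ Finset.range (n + 1), f j * fibm 3 (n + 3 - j) =
      ∑ j ∈ Finset.range (n + 1), f j * fibm 3 (n + 2 - j) +
      ∑ j ∈ Finset.range (n + 1), f j * fibm 3 (n + 1 - j) +
      ∑ j ∈ Finset.range (n + 1), f j * fibm 3 (n - j) := by
    rw [← Finset.sum_add_distrib, ← Finset.sum_add_distrib]
    refine Finset.sum_congr rfl fun j hj => ?_
    have hj : j ≤ n := Nat.lt_succ_iff.mp (Finset.mem_range.mp hj)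
    rw [Nat.sub_add_comm hj, Nat.sub_add_comm hj, Nat.sub_add_comm hj, fibm_three_add_three]
    ring
  rw [Finset.sum_range_succ _ (n + 3), Finset.sum_range_succ _ (n + 2),
    Finset.sum_range_succ _ (n + 1), h, Finset.sum_range_succ _ (n + 2),
    Finset.sum_range_succ _ (n + 1), Finset.sum_range_succ _ (n + 1)]
  have h₁ : n + 3 - (n + 1) = 2 := by omega
  have h₂ : n + 3 - (n + 2) = 1 := by omega
  have h₃ : n + 2 - (n + 1) = 1 := by omega
  simp only [h₁, h₂, h₃, Nat.sub_self, fibm_zero, fibm_one, fibm_three_two]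
  ring

theorem two_mul_sum_fibm_five_mul_fibm_three (n : ℕ) :
    2 * ∑ j ∈ Finset.range (n + 2), fibm 5 j * fibm 3 (n + 1 - j) =
      fibm 5 (n + 4) + fibm 5 (n + 2) + fibm 5 n - fibm 3 (n + 4) - fibm 3 (n + 2) := by
  induction n using Nat.strong_induction_on with
  | _ n ih =>
    match n with
    | 0 | 1 | 2 =>
      simp [Finset.sum_range_succ, fibm_zero, fibm_one, fibm_three_two, fibm_three_add_three,
        fibm_five_two, fibm_five_three, fibm_five_four, fibm_five_add_five]
    | k + 3 =>
      have h₀ := ih k (by omega)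
      have h₁ := ih (k + 1) (by omega)
      have h₂ := ih (k + 2) (by omega)
      have hC := sum_mul_fibm_three_add_three (fibm 5) (k + 1)
      have hP := fibm_five_add_five k
      have hP' := fibm_five_add_five (k + 2)
      have hT := fibm_three_add_three (k + 2)
      have hT' := fibm_three_add_three (k + 4)
      simp only [add_assoc, Nat.reduceAdd] at *
      linarith

theorem stmt_8 (n : ℕ) (hn : 1 ≤ n) :
    2 * ∑ j ∈ Finset.range (n + 1), fibm 5 j * fibm 3 (n - j) =
      fibm 5 (n + 3) + fibm 5 (n + 1) + fibm 5 (n - 1) - fibm 3 (n + 3) - fibm 3 (n + 1) := by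
  obtain ⟨k, rfl⟩ := Nat.exists_eq_add_of_le' hn
  exact two_mul_sum_fibm_five_mul_fibm_three k
end

section
/- Let m ≥ 3 be an integer. For all integers n ≥ 1, ∑_{j=0}^{n} F^{(m-2)}(j) · (F^{(m)}(n-j) − F^{(m-1)}(n-j)) = ∑_{j=0}^{n-1} F^{(m)}(j) · (F^{(m-1)}(n-1-j) − F^{(m-2)}(n-1-j)). -/
open PowerSeries in
/-- The generating function of the Fibonacci `m`-step numbers is `X / (1 - X - ⋯ - X ^ m)`. -/
theorem mk_fibm_mul_one_sub_sum (m : ℕ) :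
    PowerSeries.mk (fibm m) * (1 - ∑ j ∈ Finset.range m, (X : ℤ⟦X⟧) ^ (j + 1)) = X := by
  ext n
  rw [mul_sub, mul_one, Finset.mul_sum, map_sub, map_sum, coeff_mk]
  simp only [coeff_mul_X_pow', coeff_mk, coeff_X]
  match n with
  | 0 => simp [fibm]
  | 1 =>
    rw [fibm, Finset.sum_eq_zero]
    · simp
    · intro j _
      split_ifs with h
      · rw [show 1 - (j + 1) = 0 by omega, fibm]
      · rfl
  | n + 2 =>
    rw [fibm, if_neg (by omega), sub_eq_zero]
    refine Finset.sum_congr rfl fun j _ => ?_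
    split_ifs with h
    · rw [show n + 2 - (j + 1) = n + 1 - j by omega]
    · rw [show n + 1 - j = 0 by omega, fibm]

open PowerSeries in
theorem one_sub_sum_X_pow_ne_zero (m : ℕ) :
    (1 - ∑ j ∈ Finset.range m, (X : ℤ⟦X⟧) ^ (j + 1)) ≠ 0 := by
  intro h
  simpa using congrArg constantCoeff h

open PowerSeries in
theorem mk_fibm_mul_sub_eq (k : ℕ) :
    PowerSeries.mk (fibm k) * (PowerSeries.mk (fibm (k + 2)) - PowerSeries.mk (fibm (k + 1))) =
      X * (PowerSeries.mk (fibm (k + 2)) *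
        (PowerSeries.mk (fibm (k + 1)) - PowerSeries.mk (fibm k))) := by
  have ha := mk_fibm_mul_one_sub_sum k
  have hb := mk_fibm_mul_one_sub_sum (k + 1)
  have hc := mk_fibm_mul_one_sub_sum (k + 2)
  have hA := one_sub_sum_X_pow_ne_zero k
  have hB := one_sub_sum_X_pow_ne_zero (k + 1)
  have hC := one_sub_sum_X_pow_ne_zero (k + 2)
  have hAB := Finset.sum_range_succ (fun j => (X : ℤ⟦X⟧) ^ (j + 1)) k
  have hBC := Finset.sum_range_succ (fun j => (X : ℤ⟦X⟧) ^ (j + 1)) (k + 1)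
  set A := 1 - ∑ j ∈ Finset.range k, (X : ℤ⟦X⟧) ^ (j + 1) with hA_def
  set B := 1 - ∑ j ∈ Finset.range (k + 1), (X : ℤ⟦X⟧) ^ (j + 1) with hB_def
  set C := 1 - ∑ j ∈ Finset.range (k + 2), (X : ℤ⟦X⟧) ^ (j + 1) with hC_def
  have hAB' : A - B = X ^ (k + 1) := by rw [hA_def, hB_def, hAB]; ring
  have hBC' : B - C = X ^ (k + 2) := by rw [hB_def, hC_def, hBC]; ring
  generalize PowerSeries.mk (fibm k) = a at *
  generalize PowerSeries.mk (fibm (k + 1)) = b at *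
  generalize PowerSeries.mk (fibm (k + 2)) = c at *
  apply mul_right_cancel₀ (mul_ne_zero (mul_ne_zero hA hB) hC)
  calc a * (c - b) * (A * B * C) = a * A * (c * C * B - b * B * C) := by ring
    _ = X ^ 2 * (B - C) := by rw [ha, hb, hc]; ring
    _ = X ^ 3 * (A - B) := by rw [hAB', hBC']; ring
    _ = X * (c * C) * (b * B * A - a * A * B) := by rw [ha, hb, hc]; ring
    _ = X * (c * (b - a)) * (A * B * C) := by ring

theorem stmt_9 (m : ℕ) (hm : 3 ≤ m) (n : ℕ) (hn : 1 ≤ n) :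
    ∑ j ∈ Finset.range (n + 1), fibm (m - 2) j * (fibm m (n - j) - fibm (m - 1) (n - j)) =
      ∑ j ∈ Finset.range n, fibm m j * (fibm (m - 1) (n - 1 - j) - fibm (m - 2) (n - 1 - j)) := by
  obtain ⟨k, rfl⟩ : ∃ k, m = k + 2 := ⟨m - 2, by omega⟩
  obtain ⟨n, rfl⟩ : ∃ i, n = i + 1 := ⟨n - 1, by omega⟩
  have h := congrArg (PowerSeries.coeff (n + 1)) (mk_fibm_mul_sub_eq k)
  rw [PowerSeries.coeff_succ_X_mul, PowerSeries.coeff_mul, PowerSeries.coeff_mul,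
    Finset.Nat.sum_antidiagonal_eq_sum_range_succ_mk,
    Finset.Nat.sum_antidiagonal_eq_sum_range_succ_mk] at h
  simpa only [map_sub, PowerSeries.coeff_mk, Nat.add_sub_cancel,
    show k + 2 - 1 = k + 1 from rfl] using h
end

section
/- Let m ≥ 1 be an integer. For every integer n ≥ 0, ∑_{j=0}^{n} 2^j · F^{(m)}(n-j) = 2^{n-1+m} − F^{(m)}(n+1+m). -/
/-- The doubling recurrence, with truncated subtraction in the last index. -/
theorem fibm_add_three (k n : ℕ) :
    fibm (k + 1) (n + 3) = 2 * fibm (k + 1) (n + 2) - fibm (k + 1) (n + 1 - k) := by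
  have h₁ := fibm_add_two (k + 1) (n + 1)
  have h₂ := fibm_add_two (k + 1) n
  rw [Finset.sum_range_succ'] at h₁
  rw [Finset.sum_range_succ] at h₂
  have h₃ : ∀ j, n + 1 + 1 - (j + 1) = n + 1 - j := fun j => by omega
  simp only [h₃, Nat.sub_zero] at h₁
  rw [show n + 3 = n + 1 + 2 from rfl, h₁]
  linarith

theorem fibm_add_two_of_le (k i : ℕ) (hi : i ≤ k) : fibm (k + 1) (i + 2) = 2 ^ i := by
  induction i with
  | zero =>
    rw [fibm_add_two, Finset.sum_range_succ', Finset.sum_eq_zero]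
    · simp [fibm_one]
    · intro j _
      rw [show 0 + 1 - (j + 1) = 0 by omega, fibm_zero]
  | succ i ih =>
    rw [show i + 1 + 2 = i + 3 from rfl, fibm_add_three, ih (by omega),
      Nat.sub_eq_zero_of_le hi, fibm_zero]
    ring

theorem stmt_11 (m : ℕ) (hm : 1 ≤ m) (n : ℕ) :
    ∑ j ∈ Finset.range (n + 1), (2 : ℤ) ^ j * fibm m (n - j) =
      (2 : ℤ) ^ (n + m - 1) - fibm m (n + 1 + m) := by
  obtain ⟨k, rfl⟩ := Nat.exists_eq_add_of_le' hm
  induction n with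
  | zero =>
    rw [show 0 + 1 + (k + 1) = k + 2 by omega, fibm_add_two_of_le k k le_rfl]
    simp [fibm_zero]
  | succ n ih =>
    rw [Finset.sum_range_succ']
    have hsum : ∑ j ∈ Finset.range (n + 1), (2 : ℤ) ^ (j + 1) * fibm (k + 1) (n + 1 - (j + 1)) =
        2 * ∑ j ∈ Finset.range (n + 1), (2 : ℤ) ^ j * fibm (k + 1) (n - j) := by
      rw [Finset.mul_sum]
      refine Finset.sum_congr rfl fun j _ => ?_
      rw [Nat.add_sub_add_right]
      ring
    have hrec := fibm_add_three k (n + k)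
    rw [show n + k + 1 - k = n + 1 by omega] at hrec
    rw [hsum, ih, show n + 1 + 1 + (k + 1) = n + k + 3 by omega, hrec,
      show n + 1 + (k + 1) = n + k + 2 by omega, show n + (k + 1) - 1 = n + k by omega,
      show n + k + 2 - 1 = n + k + 1 by omega, Nat.sub_zero]
    ring
end

section
/- Let m ≥ 2 be an integer. For all integers n ≥ 2m−1, ∑_{j=0}^{n-1} (−1)^j · (F^{(2m)}(j) − F^{(2m-2)}(j)) = (−1)^{n+1} · ∑_{j=0}^{n-2m+1} F^{(2m)}(j) · F^{(2m-2)}(n-2m+1-j). -/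
open PowerSeries in
theorem fibm_genFun_mul (m : ℕ) :
    (1 - ∑ j ∈ Finset.range m, (X : ℤ⟦X⟧) ^ (j + 1)) * mk (fibm m) = X := by
  ext n
  rw [sub_mul, one_mul, Finset.sum_mul, map_sub, map_sum]
  simp only [coeff_X_pow_mul', coeff_mk, coeff_X]
  match n with
  | 0 => simp [fibm]
  | 1 =>
    rw [Finset.sum_eq_zero]
    · simp [fibm]
    · intro j _
      split_ifs with h
      · obtain rfl : j = 0 := by omega
        simp [fibm]
      · rfl
  | n + 2 =>
    rw [fibm, if_neg (by omega), sub_eq_zero]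
    refine Finset.sum_congr rfl fun j _ => ?_
    split_ifs with h
    · congr 1
      omega
    · rw [Nat.sub_eq_zero_of_le (by omega), fibm]

open PowerSeries in
theorem fibm_genFun_sub (k : ℕ) :
    (mk (fibm (k + 2)) - mk (fibm k) : ℤ⟦X⟧) =
      X ^ k * (1 + X) * (mk (fibm (k + 2)) * mk (fibm k)) := by
  have h := fibm_genFun_mul k
  have h' := fibm_genFun_mul (k + 2)
  rw [Finset.sum_range_succ, Finset.sum_range_succ] at h'
  apply mul_left_cancel₀ (X_ne_zero (R := ℤ))
  linear_combination mk (fibm k) * h' - mk (fibm (k + 2)) * h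

open PowerSeries in
theorem sum_alternating_fibm_sub (k n : ℕ) :
    ∑ j ∈ Finset.range n, (-1 : ℤ) ^ j * (fibm (k + 2) j - fibm k j) =
      (-1) ^ (n + 1) * coeff n (X ^ (k + 1) * (mk (fibm (k + 2)) * mk (fibm k))) := by
  induction n with
  | zero => simp [coeff_X_pow_mul']
  | succ n ih =>
    have h := congrArg (coeff n) (fibm_genFun_sub k)
    rw [mul_add, mul_one, add_mul, ← pow_succ, map_sub, map_add, coeff_mk, coeff_mk] at h
    rw [Finset.sum_range_succ, ih, h, pow_succ' X k, mul_assoc X,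
      coeff_succ_X_mul]
    ring

theorem stmt_12 (m : ℕ) (hm : 2 ≤ m) (n : ℕ) (hn : 2 * m - 1 ≤ n) :
    ∑ j ∈ Finset.range n, (-1 : ℤ) ^ j * (fibm (2 * m) j - fibm (2 * m - 2) j) =
      (-1 : ℤ) ^ (n + 1) *
        ∑ j ∈ Finset.range (n + 2 - 2 * m), fibm (2 * m) j * fibm (2 * m - 2) (n + 1 - 2 * m - j) := by
  obtain ⟨k, hk⟩ : ∃ k, 2 * m = k + 2 := ⟨2 * m - 2, by omega⟩
  obtain ⟨d, rfl⟩ : ∃ d, n = d + (k + 1) := ⟨n - (k + 1), by omega⟩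
  rw [hk, Nat.add_sub_cancel, sum_alternating_fibm_sub, PowerSeries.coeff_X_pow_mul,
    PowerSeries.coeff_mul, Finset.Nat.sum_antidiagonal_eq_sum_range_succ_mk,
    show d + (k + 1) + 2 - (k + 2) = d + 1 by omega,
    show d + (k + 1) + 1 - (k + 2) = d by omega]
  simp only [PowerSeries.coeff_mk]
end

section
/- For every integer n ≥ 0, 2 · ∑_{j=0}^{n} J(j) · T(n-j) = 2·J(n+1) + J(n+2) − T(n+3) − T(n+1). -/
/-- Jacobsthal numbers: `jac 0 = 0`, `jac 1 = 1`, `jac (n+2) = jac (n+1) + 2 * jac n`. -/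
def jac : ℕ → ℤ
  | 0 => 0
  | 1 => 1
  | n + 2 => jac (n + 1) + 2 * jac n

theorem fibm_three_zero : fibm 3 0 = 0 := by rw [fibm]

theorem fibm_three_one : fibm 3 1 = 1 := by rw [fibm]

theorem stmt_15 (n : ℕ) :
    2 * ∑ j ∈ Finset.range (n + 1), jac j * fibm 3 (n - j) =
      2 * jac (n + 1) + jac (n + 2) - fibm 3 (n + 3) - fibm 3 (n + 1) := by
  induction n using Nat.strong_induction_on with
  | _ n ih =>
    match n with
    | 0 => simp [fibm_three_add_three, fibm_three_zero, fibm_three_one, fibm_three_two, jac]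
    | 1 =>
      simp [Finset.sum_range_succ, fibm_three_add_three, fibm_three_zero, fibm_three_one,
        fibm_three_two, jac]
    | 2 =>
      simp [Finset.sum_range_succ, fibm_three_add_three, fibm_three_zero, fibm_three_one,
        fibm_three_two, jac]
    | k + 3 =>
      have h0 := ih k (by omega)
      have h1 := ih (k + 1) (by omega)
      have h2 := ih (k + 2) (by omega)
      have hT6 := fibm_three_add_three (k + 3)
      have hT4 := fibm_three_add_three (k + 1)
      have hJ3 : jac (k + 3) = jac (k + 2) + 2 * jac (k + 1) := by rw [jac]
      have hJ4 : jac (k + 4) = jac (k + 3) + 2 * jac (k + 2) := by rw [jac]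
      have hJ5 : jac (k + 5) = jac (k + 4) + 2 * jac (k + 3) := by rw [jac]
      have hS := sum_mul_fibm_three_add_three jac k
      simp only [Nat.add_assoc, Nat.reduceAdd] at *
      linarith
end

section
/- For every integer n ≥ 0, ∑_{j=0}^{n} 𝒫(j) · F(n-j) = 𝒫(n) − F(n). -/
/-- Pell numbers: `pell 0 = 0`, `pell 1 = 1`, `pell (n+2) = 2 * pell (n+1) + pell n`. -/
def pell : ℕ → ℤ
  | 0 => 0
  | 1 => 1
  | n + 2 => 2 * pell (n + 1) + pell n

theorem sum_pell_mul_fibm_two_add_two (n : ℕ) :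
    ∑ j ∈ Finset.range (n + 3), pell j * fibm 2 (n + 2 - j) =
      ∑ j ∈ Finset.range (n + 2), pell j * fibm 2 (n + 1 - j) +
        ∑ j ∈ Finset.range (n + 1), pell j * fibm 2 (n - j) + pell (n + 1) := by
  have h : ∑ j ∈ Finset.range (n + 1), pell j * fibm 2 (n + 2 - j) =
      ∑ j ∈ Finset.range (n + 1), pell j * fibm 2 (n + 1 - j) +
        ∑ j ∈ Finset.range (n + 1), pell j * fibm 2 (n - j) := by
    rw [← Finset.sum_add_distrib]
    refine Finset.sum_congr rfl fun j hj => ?_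
    have hj : j ≤ n := Nat.lt_succ_iff.mp (Finset.mem_range.mp hj)
    rw [Nat.sub_add_comm hj, Nat.sub_add_comm hj, fibm_two_add_two, mul_add]
  have h0 : fibm 2 0 = 0 := by rw [fibm]
  have h1 : fibm 2 1 = 1 := by rw [fibm]
  rw [Finset.sum_range_succ _ (n + 2), Finset.sum_range_succ _ (n + 1),
    Finset.sum_range_succ _ (n + 1), h, Nat.sub_self, Nat.sub_self,
    show n + 2 - (n + 1) = 1 by omega, h0, h1]
  ring

theorem stmt_17 (n : ℕ) :
    ∑ j ∈ Finset.range (n + 1), pell j * fibm 2 (n - j) = pell n - fibm 2 n := by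
  induction n using Nat.twoStepInduction with
  | zero => simp [pell, fibm]
  | one => simp [Finset.sum_range_succ, pell, fibm]
  | more n ih₀ ih₁ =>
    rw [sum_pell_mul_fibm_two_add_two, ih₀, ih₁, fibm_two_add_two, pell]
    ring
end
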